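/- Let M = {1^{k_1}, 2^{k_2}, ..., n^{k_n}} be a multiset with each k_i ≥ 1 and K = k_1 + k_2 + ... + k_n. Then the polynomial T_M(x,y,z) = Σ_{T ∈ 𝒯_M} x^{casc(T)} y^{cdes(T)} z^{eleaf(T)} is partial γ-positive; more precisely, T_M(x,y,z) = Σ_{i=0}^{K−n} z^i Σ_{j=1}^{⌊(K+1−i)/2⌋} γ_{i,j} (xy)^j (x+y)^{K+1−i−2j}, where γ_{i,j} is the number of trees T ∈ 𝒯_M with cdes(T) = j, eleaf(T) = i and dcdes(T) = 0. -/

import Mathlib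

/-! Common definitions: words (permutations of multisets), their statistics,
ordered labeled trees and their cyclic statistics. -/

attribute [local instance] Classical.propDecidable

/-- `asc`: number of indices `0 ≤ i ≤ m` with `π_i < π_{i+1}`, convention `π_0 = π_{m+1} = 0`. -/
def ascW (w : List ℕ) : ℕ :=
  (((0 :: (w ++ [0])).zip (w ++ [0])).countP fun p => decide (p.1 < p.2))

def desW (w : List ℕ) : ℕ :=
  (((0 :: (w ++ [0])).zip (w ++ [0])).countP fun p => decide (p.2 < p.1))

def platW (w : List ℕ) : ℕ :=
  (((0 :: (w ++ [0])).zip (w ++ [0])).countP fun p => decide (p.1 = p.2))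

/-- quasi-Stirling: no indices `i < j < k < l` with `π_i = π_k` and `π_j = π_l`. -/
def IsQuasiStirling (w : List ℕ) : Prop :=
  ¬ ∃ l, l < w.length ∧ ∃ k, k < l ∧ ∃ j, j < k ∧ ∃ i, i < j ∧
      w.getD i 0 = w.getD k 0 ∧ w.getD j 0 = w.getD l 0

/-- Stirling: no indices `i < j < k` with `π_i = π_k` and `π_j < π_i`. -/
def IsStirling (w : List ℕ) : Prop :=
  ¬ ∃ k, k < w.length ∧ ∃ j, j < k ∧ ∃ i, i < j ∧
      w.getD i 0 = w.getD k 0 ∧ w.getD j 0 < w.getD i 0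

/-- The multiset `{1^{k 1}, 2^{k 2}, …, n^{k n}}`. -/
def msetM (n : ℕ) (k : ℕ → ℕ) : Multiset ℕ :=
  ∑ i ∈ Finset.Icc 1 n, Multiset.replicate (k i) i

/-- The finite set of all words whose multiset of letters is `M`. -/
noncomputable def permsOf (M : Multiset ℕ) : Finset (List ℕ) :=
  M.toList.permutations.toFinset

/-- The finite set of quasi-Stirling permutations of `M`. -/
noncomputable def qsPerms (M : Multiset ℕ) : Finset (List ℕ) :=
  (permsOf M).filter IsQuasiStirling

/-- The finite set of Stirling permutations of `M`. -/
noncomputable def sPerms (M : Multiset ℕ) : Finset (List ℕ) :=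
  (permsOf M).filter IsStirling

open MvPolynomial in
/-- `Q̄_M(x,y,z)`, with `x = X 0`, `y = X 1`, `z = X 2`. -/
noncomputable def QbarPoly (M : Multiset ℕ) : MvPolynomial (Fin 3) ℤ :=
  ∑ w ∈ qsPerms M, X 0 ^ ascW w * X 1 ^ desW w * X 2 ^ platW w

open MvPolynomial in
/-- `Q_M(x,y,z)`, with `x = X 0`, `y = X 1`, `z = X 2`. -/
noncomputable def QPoly (M : Multiset ℕ) : MvPolynomial (Fin 3) ℤ :=
  ∑ w ∈ sPerms M, X 0 ^ ascW w * X 1 ^ desW w * X 2 ^ platW w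

/-! Cyclic statistics of a word `w_0 w_1 … w_ℓ` read cyclically. -/

/-- Number of cyclic descents of a word: indices `i` with `w_i > w_{i+1}`, indices mod `ℓ+1`. -/
def cdesW (w : List ℕ) : ℕ := ((w.zip (w.rotate 1)).countP fun p => decide (p.2 < p.1))

/-- Number of cyclic ascents. -/
def cascW (w : List ℕ) : ℕ := ((w.zip (w.rotate 1)).countP fun p => decide (p.1 < p.2))

/-- The list of cyclic triples `(w_{i-1}, w_i, w_{i+1})`, indices mod `ℓ+1`. -/
def cycTriples (w : List ℕ) : List (ℕ × ℕ × ℕ) :=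
  (w.rotate (w.length - 1)).zip (w.zip (w.rotate 1))

/-- Number of double cyclic descents of a word: indices with `w_{i-1} > w_i > w_{i+1}`. -/
def dcdesW (w : List ℕ) : ℕ :=
  ((cycTriples w).countP fun p => decide (p.2.1 < p.1 ∧ p.2.2 < p.2.1))

/-- Number of double cyclic ascents of a word: indices with `w_{i-1} < w_i < w_{i+1}`. -/
def dcascW (w : List ℕ) : ℕ :=
  ((cycTriples w).countP fun p => decide (p.1 < p.2.1 ∧ p.2.1 < p.2.2))

/-- Number of cyclic peaks of a word: indices with `w_{i-1} < w_i > w_{i+1}`. -/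
def cpeakW (w : List ℕ) : ℕ :=
  ((cycTriples w).countP fun p => decide (p.1 < p.2.1 ∧ p.2.2 < p.2.1))

/-- Number of cyclic valleys of a word: indices with `w_{i-1} > w_i < w_{i+1}`. -/
def cvalW (w : List ℕ) : ℕ :=
  ((cycTriples w).countP fun p => decide (p.2.1 < p.1 ∧ p.2.1 < p.2.2))

/-- Ordered labeled trees: rooted plane trees with labels in `ℕ`. -/
inductive LTree : Type where
  | node (label : ℕ) (children : List LTree) : LTree

namespace LTree

/-- The label of the root. -/
def label : LTree → ℕ
  | node a _ => a

theorem sizeOf_lt_of_mem {s : LTree} {ts : List LTree} (h : s ∈ ts) {a : ℕ} :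
    sizeOf s < sizeOf (LTree.node a ts) := by
  have := List.sizeOf_lt_of_mem h
  simp only [node.sizeOf_spec]
  omega

/-- The multiset of all vertex labels. -/
def labels : LTree → Multiset ℕ
  | node a ts => a ::ₘ (ts.attach.map (fun s => labels s.1)).sum
decreasing_by exact sizeOf_lt_of_mem s.2

/-- The word `v_0 v_1 … v_ℓ` associated to a vertex: its label followed by the labels of
its children from left to right. -/
def wordOf : LTree → List ℕ
  | node a ts => a :: ts.map label

/-- `cdes(T) = ∑_{u ∈ V(T)} cdes(u)`. -/
def cdes : LTree → ℕ
  | node a ts => cdesW (a :: ts.map label) + (ts.attach.map (fun s => cdes s.1)).sum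
decreasing_by exact sizeOf_lt_of_mem s.2

/-- `casc(T) = ∑_{u ∈ V(T)} casc(u)`. -/
def casc : LTree → ℕ
  | node a ts => cascW (a :: ts.map label) + (ts.attach.map (fun s => casc s.1)).sum
decreasing_by exact sizeOf_lt_of_mem s.2

/-- Auxiliary: number of leaves at even level, `b = true` meaning the current root is at
even level. -/
def eleafAux : LTree → Bool → ℕ
  | node _ ts, b => (cond b (if ts.isEmpty then 1 else 0) 0)
      + (ts.attach.map (fun s => eleafAux s.1 !b)).sum
decreasing_by exact sizeOf_lt_of_mem s.2

/-- `eleaf(T)`: the number of leaves of `T` at even level. -/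
def eleaf (T : LTree) : ℕ := eleafAux T true

/-- Auxiliary: given a word-statistic `f`, sum `f (wordOf u)` over all vertices `u` at even
level (`b = true` meaning the current root is at even level).  Since every vertex of a tree
is classified (as a double cyclic descent/ascent, cyclic peak/valley) by exactly one index
of the word of an even vertex — an even vertex by index `0` of its own word, an odd vertex
by its position in the word of its (even) parent — the corresponding tree statistics are
obtained by summing the word statistics over the even vertices. -/
def evenSum (f : List ℕ → ℕ) : LTree → Bool → ℕ
  | node a ts, b => (cond b (f (a :: ts.map label)) 0)
      + (ts.attach.map (fun s => evenSum f s.1 !b)).sum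
decreasing_by exact sizeOf_lt_of_mem s.2

/-- `dcdes(T)`: the number of vertices of `T` that are double cyclic descents. -/
def dcdes (T : LTree) : ℕ := evenSum dcdesW T true

/-- `dcasc(T)`: the number of vertices of `T` that are double cyclic ascents. -/
def dcasc (T : LTree) : ℕ := evenSum dcascW T true

/-- `cpeak(T)`: the number of vertices of `T` that are cyclic peaks. -/
def cpeak (T : LTree) : ℕ := evenSum cpeakW T true

/-- `cval(T)`: the number of vertices of `T` that are cyclic valleys. -/
def cval (T : LTree) : ℕ := evenSum cvalW T true

/-- Auxiliary: every odd vertex labeled `i` has exactly `k i - 1` children, all labeled `i`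
(`b = true` meaning the current root is at even level). -/
def oddOK (k : ℕ → ℕ) : LTree → Bool → Prop
  | node a ts, b => (b = false → (ts.length = k a - 1 ∧ ∀ s ∈ ts, s.label = a)) ∧
      ∀ s : {x // x ∈ ts}, oddOK k s.1 (!b)
decreasing_by exact sizeOf_lt_of_mem s.2

/-- Weakly increasing: the labels along the path from the root to any leaf are weakly
increasing from top to bottom, i.e. every child's label is at least its parent's label. -/
def incr : LTree → Prop
  | node a ts => (∀ s ∈ ts, a ≤ s.label) ∧ ∀ s : {x // x ∈ ts}, incr s.1
decreasing_by exact sizeOf_lt_of_mem s.2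

end LTree

/-- Membership in `𝒯_M` for `M = {1^{k 1}, …, n^{k n}}`: the multiset of vertex labels is
`{0} ∪ M`, the root is labeled `0`, and every odd vertex labeled `i` has exactly `k i - 1`
children, all labeled `i`. -/
def memTM (n : ℕ) (k : ℕ → ℕ) (T : LTree) : Prop :=
  T.label = 0 ∧ T.labels = 0 ::ₘ msetM n k ∧ T.oddOK k true

/-- Membership in `ℐ𝒯_M`: weakly increasing trees in `𝒯_M`. -/
def memIT (n : ℕ) (k : ℕ → ℕ) (T : LTree) : Prop :=
  memTM n k T ∧ T.incr

/-! ### Ascent patterns of cyclic words -/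

section Pattern

/-- The ascent pattern of the path `a, l_1, …, l_m, c`: `true` marks an ascent. -/
def ascPattern : ℕ → List ℕ → ℕ → List Bool
  | a, [], c => [decide (a < c)]
  | a, y :: l, c => decide (a < y) :: ascPattern y l c

/-- All words obtained from a word of bits by replacing one letter with `b, !b`. -/
def splitAll (b : Bool) : List Bool → List (List Bool)
  | [] => []
  | x :: l => (b :: (!b) :: l) :: (splitAll b l).map (List.cons x)

theorem map_ascPattern_insert_max {e : ℕ} (l : List ℕ) {a c : ℕ} (ha : a < e) (hc : c < e)
    (hl : ∀ y ∈ l, y < e) :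
    (List.permutations'Aux e l).map (fun τ => ascPattern a τ c)
      = splitAll true (ascPattern a l c) := by
  induction l generalizing a with
  | nil => simp [ascPattern, splitAll, ha, hc.le]
  | cons y l ih =>
    have hy : y < e := hl y (by simp)
    have := ih hy (fun z hz => hl z (by simp [hz]))
    simp [ascPattern, splitAll, ha, hy.le, ← this, Function.comp_def]

theorem map_ascPattern_insert_min {e : ℕ} (l : List ℕ) {a c : ℕ} (ha : e < a) (hc : e < c)
    (hl : ∀ y ∈ l, e < y) :
    (List.permutations'Aux e l).map (fun τ => ascPattern a τ c)
      = splitAll false (ascPattern a l c) := by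
  induction l generalizing a with
  | nil => simp [ascPattern, splitAll, ha.le, hc]
  | cons y l ih =>
    have hy : e < y := hl y (by simp)
    have := ih hy (fun z hz => hl z (by simp [hz]))
    simp [ascPattern, splitAll, ha.le, hy, ← this, Function.comp_def]

open MvPolynomial

/-- The generic weight of a path of bits: the product of the variables indexed by its
consecutive pairs. -/
noncomputable def pathWeight : Bool → List Bool → MvPolynomial (Bool × Bool) ℤ
  | _, [] => 1
  | b, x :: l => X (b, x) * pathWeight x l

/-- The generic weight of a cyclic word of bits. -/
noncomputable def cycWeight : List Bool → MvPolynomial (Bool × Bool) ℤ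
  | [] => 1
  | b :: l => pathWeight b (l ++ [b])

/-- The derivation describing the effect of `splitAll b` on weights. -/
noncomputable def splitDer (b : Bool) :
    Derivation ℤ (MvPolynomial (Bool × Bool) ℤ) (MvPolynomial (Bool × Bool) ℤ) :=
  mkDerivation ℤ fun p =>
    (if p.1 = b then X (b, !b) * X (!b, p.2) else 0)
      + (if p.2 = !b then X (b, !b) * X (p.1, b) else 0)

theorem splitDer_pathWeight (b p q : Bool) (l : List Bool) :
    splitDer b (pathWeight p (l ++ [q])) =
      ((splitAll b l).map fun γ => pathWeight p (γ ++ [q])).sum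
        + (if p = b then X (b, !b) * pathWeight (!b) (l ++ [q]) else 0)
        + (if q = !b then X (b, !b) * pathWeight p (l ++ [b]) else 0) := by
  induction l generalizing p with
  | nil => simp [pathWeight, splitAll, splitDer, mkDerivation_X]
  | cons x l ih =>
    have h : ((splitAll b l).map fun γ => pathWeight p (x :: γ ++ [q])).sum
        = X (p, x) * ((splitAll b l).map fun γ => pathWeight x (γ ++ [q])).sum := by
      simp [pathWeight, List.sum_map_mul_left]
    simp only [List.cons_append, pathWeight, Derivation.leibniz, ih, splitAll, List.map_cons,
      List.sum_cons, List.map_map, Function.comp_def, smul_eq_mul] at h ⊢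
    rw [h]
    simp only [splitDer, mkDerivation_X]
    cases b <;> cases p <;> cases x <;> cases q <;> simp <;> ring

theorem sum_cycWeight_splitAll (b : Bool) {l : List Bool} (hl : l ≠ []) :
    ((splitAll b l).map cycWeight).sum = splitDer b (cycWeight l) := by
  cases l with
  | nil => exact absurd rfl hl
  | cons p l =>
    simp only [cycWeight, splitDer_pathWeight, splitAll, List.map_cons, List.sum_cons,
      List.map_map, Function.comp_def, List.cons_append, pathWeight]
    cases b <;> cases p <;> simp <;> ring

/-- The generators of the algebra of weights that only depend on `w(↑↓) w(↓↑)` and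
`w(↑↑) + w(↓↓)`. -/
def gammaGens : Set (MvPolynomial (Bool × Bool) ℤ) :=
  {X (true, false) * X (false, true), X (true, true) + X (false, false)}

theorem splitDer_mem_adjoin (b : Bool) {f : MvPolynomial (Bool × Bool) ℤ}
    (hf : f ∈ Algebra.adjoin ℤ gammaGens) : splitDer b f ∈ Algebra.adjoin ℤ gammaGens := by
  have h₁ : X (true, false) * X (false, true) ∈ Algebra.adjoin ℤ gammaGens :=
    Algebra.subset_adjoin (by simp [gammaGens])
  have h₂ : X (true, true) + X (false, false) ∈ Algebra.adjoin ℤ gammaGens :=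
    Algebra.subset_adjoin (by simp [gammaGens])
  induction hf using Algebra.adjoin_induction with
  | mem x hx =>
    rcases hx with rfl | rfl
    · convert mul_mem h₁ h₂ using 1
      cases b <;> simp [splitDer, mkDerivation_X] <;> ring
    · convert add_mem h₁ h₁ using 1
      cases b <;> simp [splitDer, mkDerivation_X, mul_comm]
  | algebraMap r => simp
  | add x y _ _ hx hy => rw [map_add]; exact add_mem hx hy
  | mul x y hx' hy' hx hy =>
    rw [Derivation.leibniz, smul_eq_mul, smul_eq_mul]
    exact add_mem (mul_mem hx' hy) (mul_mem hy' hx)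

theorem exists_extreme_mem (a : ℕ) {l : List ℕ} (hl : l ≠ []) (h : (a :: l).Nodup) :
    ∃ e ∈ l, (a < e ∧ ∀ y ∈ l.erase e, y < e) ∨ (e < a ∧ ∀ y ∈ l.erase e, e < y) := by
  have hne : l.toFinset.Nonempty := by
    simpa [Finset.nonempty_iff_ne_empty] using hl
  obtain ⟨ha, hnd⟩ := List.nodup_cons.1 h
  obtain ⟨M, hM, hmax⟩ := l.toFinset.exists_max_image id hne
  obtain ⟨m, hm, hmin⟩ := l.toFinset.exists_min_image id hne
  simp only [List.mem_toFinset, id] at hM hmax hm hmin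
  rcases lt_or_ge a M with haM | haM
  · refine ⟨M, hM, Or.inl ⟨haM, fun y hy => ?_⟩⟩
    rw [hnd.mem_erase_iff] at hy
    exact lt_of_le_of_ne (hmax y hy.2) hy.1
  · refine ⟨m, hm, Or.inr ⟨?_, fun y hy => ?_⟩⟩
    · exact lt_of_le_of_ne ((hmax m hm).trans haM) (fun h => ha (h ▸ hm))
    · rw [hnd.mem_erase_iff] at hy
      exact lt_of_le_of_ne (hmin y hy.2) (Ne.symm hy.1)

theorem ascPattern_ne_nil (a : ℕ) (l : List ℕ) (c : ℕ) : ascPattern a l c ≠ [] := by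
  cases l <;> simp [ascPattern]

theorem sum_cycWeight_insert {a e : ℕ} {l : List ℕ}
    (h : (a < e ∧ ∀ y ∈ l, y < e) ∨ (e < a ∧ ∀ y ∈ l, e < y)) :
    ∃ b, ∀ τ ∈ l.permutations',
      ((List.permutations'Aux e τ).map fun τ => cycWeight (ascPattern a τ a)).sum
        = splitDer b (cycWeight (ascPattern a τ a)) := by
  rcases h with ⟨ha, hl⟩ | ⟨ha, hl⟩
  · refine ⟨true, fun τ hτ => ?_⟩
    rw [← sum_cycWeight_splitAll _ (ascPattern_ne_nil a τ a), ← map_ascPattern_insert_max τ ha ha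
      fun y hy => hl y ((List.mem_permutations'.1 hτ).mem_iff.1 hy), List.map_map]
    rfl
  · refine ⟨false, fun τ hτ => ?_⟩
    rw [← sum_cycWeight_splitAll _ (ascPattern_ne_nil a τ a), ← map_ascPattern_insert_min τ ha ha
      fun y hy => hl y ((List.mem_permutations'.1 hτ).mem_iff.1 hy), List.map_map]
    rfl

theorem list_sum_map_flatMap {α β M : Type*} [AddMonoid M] (l : List α) (f : α → List β)
    (g : β → M) :
    ((l.flatMap f).map g).sum = (l.map fun a => ((f a).map g).sum).sum := by
  induction l with
  | nil => rfl
  | cons a l ih => simp [List.flatMap_cons, ih]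

theorem sum_cycWeight_mem_adjoin (a : ℕ) (l : List ℕ) (hl : l ≠ []) (h : (a :: l).Nodup) :
    (l.permutations'.map fun τ => cycWeight (ascPattern a τ a)).sum
      ∈ Algebra.adjoin ℤ gammaGens := by
  induction hm : l.length generalizing l with
  | zero => simp_all
  | succ m ih =>
    obtain ⟨e, he, hext⟩ := exists_extreme_mem a hl h
    have hperm := List.perm_cons_erase he
    rw [(hperm.permutations'.map _).sum_eq, List.permutations', list_sum_map_flatMap]
    by_cases hl' : l.erase e = []
    · rw [hl']
      have h₁ : X (true, false) * X (false, true) ∈ Algebra.adjoin ℤ gammaGens :=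
        Algebra.subset_adjoin (by simp [gammaGens])
      rcases hext with ⟨h, -⟩ | ⟨h, -⟩
      · simpa [List.permutations', ascPattern, cycWeight, pathWeight, h, h.not_gt] using h₁
      · rw [mul_comm] at h₁
        simpa [List.permutations', ascPattern, cycWeight, pathWeight, h, h.not_gt] using h₁
    · obtain ⟨b, hb⟩ := sum_cycWeight_insert hext
      rw [List.map_congr_left hb]
      have hsub : (a :: l.erase e).Nodup :=
        h.sublist ((List.erase_sublist).cons_cons a)
      have hlen : (l.erase e).length = m := by
        rw [List.length_erase_of_mem he, hm]; rfl
      have := splitDer_mem_adjoin b (ih _ hl' hsub hlen)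
      rwa [map_list_sum, List.map_map] at this

/-- Two specializations agreeing on the generators give equal weighted sums over the cyclic
arrangements of a set of at least two letters. -/
theorem sum_map_cycWeight_eq {R : Type*} [CommRing R]
    (φ ψ : MvPolynomial (Bool × Bool) ℤ →ₐ[ℤ] R) (hφψ : Set.EqOn φ ψ gammaGens)
    {a : ℕ} {l : List ℕ} (hl : l ≠ []) (h : (a :: l).Nodup) :
    (l.permutations'.map fun τ => φ (cycWeight (ascPattern a τ a))).sum
      = (l.permutations'.map fun τ => ψ (cycWeight (ascPattern a τ a))).sum := by
  have := AlgHom.adjoin_le_equalizer φ ψ hφψ (sum_cycWeight_mem_adjoin a l hl h)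
  rw [AlgHom.mem_equalizer, map_list_sum, map_list_sum, List.map_map, List.map_map] at this
  exact this

end Pattern

/-! ### Cyclic statistics in terms of the ascent pattern -/

section WordStatistics

theorem zip_map_ascPattern (a : ℕ) (l : List ℕ) (c : ℕ) :
    (((a :: l).zip (l ++ [c])).map fun p => decide (p.1 < p.2)) = ascPattern a l c := by
  induction l generalizing a with
  | nil => simp [ascPattern]
  | cons y l ih => simp [ascPattern, ← ih]

theorem cascW_cons (a : ℕ) (l : List ℕ) : cascW (a :: l) = (ascPattern a l a).count true := by
  rw [cascW, ← zip_map_ascPattern, List.count, List.countP_map]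
  simp [Function.comp_def]

theorem isChain_ne_of_nodup {a : ℕ} {l : List ℕ} (hl : l ≠ []) (h : (a :: l).Nodup) :
    List.IsChain (· ≠ ·) (a :: (l ++ [a])) := by
  have h' : List.IsChain (· ≠ ·) (a :: l) := (List.Pairwise.isChain h)
  rw [← List.cons_append]
  refine List.IsChain.append h' (by simp) ?_
  intro x hx y hy
  have hx' : x ∈ l := by
    rw [List.getLast?_cons, List.getLast?_eq_some_getLast hl] at hx
    simp at hx
    exact hx ▸ List.getLast_mem hl
  have hy' : y = a := by simpa [eq_comm] using hy
  rintro rfl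
  exact (List.nodup_cons.1 h).1 (hy' ▸ hx')

theorem countP_zip_descent {a : ℕ} {l : List ℕ} {c : ℕ}
    (h : List.IsChain (· ≠ ·) (a :: (l ++ [c]))) :
    ((a :: l).zip (l ++ [c])).countP (fun p => decide (p.2 < p.1))
      = (ascPattern a l c).count false := by
  induction l generalizing a with
  | nil =>
    have : a ≠ c := by simpa using h
    rcases this.lt_or_gt with h | h <;> simp [ascPattern, h, h.not_gt]
  | cons y l ih =>
    rw [List.cons_append, List.isChain_cons_cons] at h
    have hih := ih h.2
    rw [List.cons_append, List.zip_cons_cons, List.countP_cons, hih, ascPattern, List.count_cons]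
    rcases h.1.lt_or_gt with h | h <;> simp [h, h.not_gt]

theorem cdesW_cons {a : ℕ} {l : List ℕ} (hl : l ≠ []) (h : (a :: l).Nodup) :
    cdesW (a :: l) = (ascPattern a l a).count false := by
  rw [cdesW, ← countP_zip_descent (isChain_ne_of_nodup hl h)]
  simp

/-- The number of consecutive pairs of descents in a path of bits. -/
def descPairs : Bool → List Bool → ℕ
  | _, [] => 0
  | b, x :: l => (if b = false ∧ x = false then 1 else 0) + descPairs x l

theorem countP_triples_eq_descPairs {z a : ℕ} {l : List ℕ} {c : ℕ}
    (h : List.IsChain (· ≠ ·) (z :: a :: (l ++ [c]))) :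
    ((z :: (a :: l).dropLast).zip ((a :: l).zip (l ++ [c]))).countP
        (fun p => decide (p.2.1 < p.1 ∧ p.2.2 < p.2.1))
      = descPairs (decide (z < a)) (ascPattern a l c) := by
  induction l generalizing z a with
  | nil =>
    simp only [List.nil_append, List.isChain_cons_cons] at h
    rcases h.1.lt_or_gt with h₁ | h₁ <;> rcases h.2.1.lt_or_gt with h₂ | h₂ <;>
      simp [descPairs, ascPattern, h₁, h₂, h₁.not_gt, h₂.not_gt]
  | cons y l ih =>
    rw [List.cons_append, List.isChain_cons_cons] at h
    have hih := ih h.2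
    have h₂' := (List.isChain_cons_cons.1 h.2).1
    rw [List.dropLast_cons_cons, List.cons_append, List.zip_cons_cons, List.zip_cons_cons,
      List.countP_cons, hih, ascPattern, descPairs]
    rcases h.1.lt_or_gt with h₁ | h₁ <;> rcases h₂'.lt_or_gt with h₂ | h₂ <;>
      simp [h₁, h₂, h₁.not_gt, h₂.not_gt, add_comm]

theorem ascPattern_append (a : ℕ) (l : List ℕ) (z c : ℕ) :
    ascPattern a (l ++ [z]) c = ascPattern a l z ++ [decide (z < c)] := by
  induction l generalizing a with
  | nil => simp [ascPattern]
  | cons y l ih => simp [ascPattern, ih]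

theorem dcdesW_cons {a : ℕ} {l : List ℕ} (hl : l ≠ []) (h : (a :: l).Nodup) :
    dcdesW (a :: l) = descPairs ((ascPattern a l a).getLast (ascPattern_ne_nil a l a))
      (ascPattern a l a) := by
  have hch := isChain_ne_of_nodup hl h
  obtain ⟨l, z, rfl⟩ := List.eq_nil_or_concat l |>.resolve_left hl
  rw [List.concat_eq_append] at *
  have hza : z ≠ a := by
    rintro rfl
    simp at h
  have hrot : (a :: (l ++ [z])).rotate (l.length + 1) = z :: a :: l := by
    exact List.rotate_append_length_eq (a :: l) [z]
  have hlast : (ascPattern a (l ++ [z]) a).getLast (ascPattern_ne_nil _ _ _) = decide (z < a) := by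
    simp [ascPattern_append]
  have := countP_triples_eq_descPairs (List.isChain_cons_cons.2 ⟨hza, hch⟩)
  rw [hlast, ← this, dcdesW, cycTriples]
  have hd : (a :: (l ++ [z])).dropLast = a :: l := by
    rw [← List.cons_append, List.dropLast_concat]
  simp only [List.length_cons, List.length_append, List.length_nil, Nat.add_sub_cancel, zero_add]
  rw [hrot, hd]
  simp

theorem length_ascPattern (a : ℕ) (l : List ℕ) (c : ℕ) :
    (ascPattern a l c).length = l.length + 1 := by
  induction l generalizing a with
  | nil => rfl
  | cons y l ih => simp [ascPattern, ih]

theorem count_false_ascPattern_pos {a : ℕ} {l : List ℕ} {c : ℕ} (h : c ≤ a) :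
    0 < (ascPattern a l c).count false := by
  induction l generalizing a with
  | nil => simp [ascPattern, h]
  | cons y l ih =>
    rw [ascPattern, List.count_cons]
    by_cases hay : a < y
    · exact Nat.add_pos_left (ih (h.trans hay.le)) _
    · simp [hay]

open MvPolynomial

theorem pathWeight_append (b : Bool) (l : List Bool) (c : Bool) :
    pathWeight b (l ++ [c])
      = pathWeight b l * X ((b :: l).getLast (by simp), c) := by
  induction l generalizing b with
  | nil => simp [pathWeight]
  | cons x l ih => simp [pathWeight, ih, mul_assoc]

theorem cycWeight_eq_pathWeight {l : List Bool} (hl : l ≠ []) :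
    cycWeight l = pathWeight (l.getLast hl) l := by
  cases l with
  | nil => exact absurd rfl hl
  | cons b l => rw [cycWeight, pathWeight_append, pathWeight, mul_comm]

variable {R : Type*} [CommRing R] (x y z : R)

/-- Specialization recording ascents by `x` and descents by `y`. -/
noncomputable def ascDescHom : MvPolynomial (Bool × Bool) ℤ →ₐ[ℤ] R :=
  aeval fun p => if p.2 then x else y

/-- Specialization killing double descents. -/
noncomputable def gammaHom : MvPolynomial (Bool × Bool) ℤ →ₐ[ℤ] R :=
  aeval fun p => if p.2 then (if p.1 then x + y else 1) else (if p.1 then x * y else 0)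

theorem ascDescHom_eqOn_gammaHom : Set.EqOn (ascDescHom x y) (gammaHom x y) gammaGens := by
  rintro _ (rfl | rfl) <;> simp [ascDescHom, gammaHom, mul_comm]

theorem ascDescHom_pathWeight (b : Bool) (l : List Bool) :
    ascDescHom x y (pathWeight b l) = x ^ l.count true * y ^ l.count false := by
  induction l generalizing b with
  | nil => simp [pathWeight]
  | cons c l ih =>
    rw [pathWeight, map_mul, ih]
    cases c <;> simp [ascDescHom, pow_succ] <;> ring

theorem gammaHom_pathWeight_of_ne {b : Bool} {l : List Bool} (h : descPairs b l ≠ 0) :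
    gammaHom x y (pathWeight b l) = 0 := by
  induction l generalizing b with
  | nil => simp [descPairs] at h
  | cons c l ih =>
    rw [pathWeight, map_mul]
    by_cases hl : descPairs c l = 0
    · have : b = false ∧ c = false := by
        by_contra hbc
        simp [descPairs, hl, hbc] at h
      simp [gammaHom, this]
    · rw [ih hl, mul_zero]

theorem gammaHom_pathWeight_of_eq {b : Bool} {l : List Bool} (h : descPairs b l = 0) :
    ∃ r, r + l.count false + (b :: l).dropLast.count false = l.length ∧
      gammaHom x y (pathWeight b l) = (x * y) ^ l.count false * (x + y) ^ r := by
  induction l generalizing b with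
  | nil => exact ⟨0, by simp [pathWeight]⟩
  | cons c l ih =>
    rw [descPairs, Nat.add_eq_zero_iff] at h
    obtain ⟨r, hr, hw⟩ := ih h.2
    rw [pathWeight, map_mul, hw, List.dropLast_cons_cons]
    cases b <;> cases c
    · simp at h
    · exact ⟨r, by simp; omega, by simp [gammaHom]⟩
    · exact ⟨r, by simp; omega, by simp [gammaHom]; ring⟩
    · exact ⟨r + 1, by simp; omega, by simp [gammaHom]; ring⟩

/-- `1` for the word of a leaf, `0` for any other word of a vertex. -/
def leafW (w : List ℕ) : ℕ := if w.length = 1 then 1 else 0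

/-- The number of letters that are not accounted for by `leafW` and pairs of descents. -/
def freeW (w : List ℕ) : ℕ := w.length - leafW w - 2 * cdesW w

/-- Weight of a word by ascents, descents, and being the word of a leaf. -/
def ascDescWeight (w : List ℕ) : R := x ^ cascW w * y ^ cdesW w * z ^ leafW w

/-- Gamma weight of a word. -/
noncomputable def gammaWeight (w : List ℕ) : R :=
  if dcdesW w = 0 then (x * y) ^ cdesW w * (x + y) ^ freeW w * z ^ leafW w else 0

theorem cdesW_singleton (a : ℕ) : cdesW [a] = 0 := by simp [cdesW]

theorem cascW_singleton (a : ℕ) : cascW [a] = 0 := by simp [cascW]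

theorem dcdesW_singleton (a : ℕ) : dcdesW [a] = 0 := by simp [dcdesW, cycTriples]

theorem cdesW_pos {a : ℕ} {l : List ℕ} (hl : l ≠ []) (h : (a :: l).Nodup) :
    0 < cdesW (a :: l) := by
  rw [cdesW_cons hl h]
  exact count_false_ascPattern_pos le_rfl

theorem count_dropLast_getLast {l : List Bool} (hl : l ≠ []) (b : Bool) :
    (l.getLast hl :: l).dropLast.count b = l.count b := by
  have hperm : (l.getLast hl :: l).dropLast.Perm l := by
    rw [List.dropLast_cons_of_ne_nil hl]
    conv_rhs => rw [← List.dropLast_append_getLast hl]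
    exact (List.perm_append_singleton _ _).symm
  exact hperm.count_eq b

theorem gammaHom_cycWeight {a : ℕ} {l : List ℕ} (hl : l ≠ []) (h : (a :: l).Nodup) :
    (dcdesW (a :: l) ≠ 0 → gammaHom x y (cycWeight (ascPattern a l a)) = 0) ∧
    (dcdesW (a :: l) = 0 → ∃ r, r + 2 * cdesW (a :: l) = (a :: l).length ∧
      gammaHom x y (cycWeight (ascPattern a l a)) = (x * y) ^ cdesW (a :: l) * (x + y) ^ r) := by
  rw [dcdesW_cons hl h, cdesW_cons hl h, cycWeight_eq_pathWeight (ascPattern_ne_nil a l a)]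
  refine ⟨gammaHom_pathWeight_of_ne x y, fun h0 => ?_⟩
  obtain ⟨r, hr, hw⟩ := gammaHom_pathWeight_of_eq x y h0
  rw [count_dropLast_getLast, length_ascPattern] at hr
  exact ⟨r, by rw [List.length_cons]; omega, hw⟩

theorem leafW_cons {a : ℕ} {l : List ℕ} (hl : l ≠ []) : leafW (a :: l) = 0 := by
  simp [leafW, hl]

theorem freeW_add {w : List ℕ} (hw : w ≠ []) (h : w.Nodup) (h0 : dcdesW w = 0) :
    freeW w + leafW w + 2 * cdesW w = w.length := by
  cases w with
  | nil => exact absurd rfl hw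
  | cons a l =>
    by_cases hl : l = []
    · subst hl
      simp [freeW, leafW, cdesW_singleton]
    · obtain ⟨r, hr, -⟩ := (gammaHom_cycWeight (0 : ℤ) 0 hl h).2 h0
      rw [freeW, leafW_cons hl]
      omega

/-- The gamma expansion of the sum over all arrangements of the children of a vertex. -/
theorem sum_ascDescWeight_eq_sum_gammaWeight {a : ℕ} {l : List ℕ} (h : (a :: l).Nodup) :
    (l.permutations'.map fun τ => ascDescWeight x y z (a :: τ)).sum
      = (l.permutations'.map fun τ => gammaWeight x y z (a :: τ)).sum := by
  by_cases hl : l = []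
  · subst hl
    simp [ascDescWeight, gammaWeight, freeW, leafW, cdesW_singleton, cascW_singleton,
      dcdesW_singleton]
  have key := sum_map_cycWeight_eq _ _ (ascDescHom_eqOn_gammaHom x y) hl h
  convert key using 2
  · refine List.map_congr_left fun τ hτ => ?_
    have hτ := List.mem_permutations'.1 hτ
    have hτl : τ ≠ [] := fun h => hl (by simpa [h] using hτ.symm)
    have hnd : (a :: τ).Nodup := (hτ.cons a).nodup_iff.2 h
    rw [cycWeight_eq_pathWeight (ascPattern_ne_nil a τ a), ascDescHom_pathWeight, ascDescWeight,
      leafW_cons hτl, cascW_cons, cdesW_cons hτl hnd, pow_zero, mul_one]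
  · refine List.map_congr_left fun τ hτ => ?_
    have hτ := List.mem_permutations'.1 hτ
    have hτl : τ ≠ [] := fun h => hl (by simpa [h] using hτ.symm)
    have hnd : (a :: τ).Nodup := (hτ.cons a).nodup_iff.2 h
    by_cases h0 : dcdesW (a :: τ) = 0
    · obtain ⟨r, hr, hw⟩ := (gammaHom_cycWeight x y hτl hnd).2 h0
      rw [hw, gammaWeight, if_pos h0, leafW_cons hτl, pow_zero, mul_one, freeW, leafW_cons hτl]
      congr 2
      omega
    · rw [(gammaHom_cycWeight x y hτl hnd).1 h0, gammaWeight, if_neg h0]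

end WordStatistics

/-! ### Trees and their even words -/

namespace LTree

theorem induct {P : LTree → Prop} (h : ∀ a ts, (∀ s ∈ ts, P s) → P (node a ts)) :
    ∀ T, P T
  | node a ts => h a ts fun s _ => induct h s

/-- The words of the even vertices of a tree (`b = true` meaning that the root is even). -/
def evenWords : LTree → Bool → List (List ℕ)
  | node a ts, b => (cond b [a :: ts.map label] [])
      ++ ts.attach.flatMap (fun s => evenWords s.1 !b)
decreasing_by exact sizeOf_lt_of_mem s.2

theorem attach_map_eq {β : Type*} (ts : List LTree) (f : LTree → β) :
    (ts.attach.map fun s => f s.1) = ts.map f := by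
  simp

theorem evenWords_node (a : ℕ) (ts : List LTree) (b : Bool) :
    evenWords (node a ts) b = (cond b [a :: ts.map label] [])
      ++ ts.flatMap (fun s => evenWords s !b) := by
  rw [evenWords, List.flatMap, List.flatMap, attach_map_eq ts fun s => evenWords s !b]

theorem labels_node (a : ℕ) (ts : List LTree) :
    labels (node a ts) = a ::ₘ (ts.map labels).sum := by
  rw [labels, attach_map_eq]

theorem cdes_node (a : ℕ) (ts : List LTree) :
    cdes (node a ts) = cdesW (a :: ts.map label) + (ts.map cdes).sum := by
  rw [cdes, attach_map_eq]

theorem casc_node (a : ℕ) (ts : List LTree) :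
    casc (node a ts) = cascW (a :: ts.map label) + (ts.map casc).sum := by
  rw [casc, attach_map_eq]

theorem eleafAux_node (a : ℕ) (ts : List LTree) (b : Bool) :
    eleafAux (node a ts) b = (cond b (if ts.isEmpty then 1 else 0) 0)
      + (ts.map (fun s => eleafAux s !b)).sum := by
  rw [eleafAux, attach_map_eq ts fun s => eleafAux s !b]

theorem evenSum_node (f : List ℕ → ℕ) (a : ℕ) (ts : List LTree) (b : Bool) :
    evenSum f (node a ts) b = (cond b (f (a :: ts.map label)) 0)
      + (ts.map (fun s => evenSum f s !b)).sum := by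
  rw [evenSum, attach_map_eq ts fun s => evenSum f s !b]

theorem oddOK_node (k : ℕ → ℕ) (a : ℕ) (ts : List LTree) (b : Bool) :
    oddOK k (node a ts) b ↔ (b = false → (ts.length = k a - 1 ∧ ∀ s ∈ ts, s.label = a)) ∧
      ∀ s ∈ ts, oddOK k s !b := by
  rw [oddOK]
  simp

theorem evenSum_eq (f : List ℕ → ℕ) (T : LTree) (b : Bool) :
    evenSum f T b = ((evenWords T b).map f).sum := by
  induction T using LTree.induct generalizing b with
  | h a ts ih =>
    rw [evenSum_node, evenWords_node, List.map_append, List.sum_append, list_sum_map_flatMap,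
      List.map_congr_left fun s hs => ih s hs (!b)]
    cases b <;> simp

theorem eleaf_eq (T : LTree) : T.eleaf = evenSum leafW T true := by
  have (T : LTree) (b : Bool) : eleafAux T b = evenSum leafW T b := by
    induction T using LTree.induct generalizing b with
    | h a ts ih =>
      rw [evenSum_node, eleafAux_node, List.map_congr_left fun s hs => ih s hs (!b)]
      cases b <;> simp [leafW]
  exact this T true

theorem countP_zip_rotate_replicate (p : ℕ × ℕ → Bool) (m a : ℕ) (hp : p (a, a) = false) :
    ((List.replicate m a).zip ((List.replicate m a).rotate 1)).countP p = 0 := by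
  rw [List.rotate_replicate, List.countP_eq_zero]
  rintro ⟨u, v⟩ huv
  have hu := List.eq_of_mem_replicate (List.of_mem_zip huv).1
  have hv := List.eq_of_mem_replicate (List.of_mem_zip huv).2
  simp [hu, hv, hp]

theorem map_label_of_oddOK {k : ℕ → ℕ} {a : ℕ} {ts : List LTree}
    (h : oddOK k (node a ts) false) : ts.map label = List.replicate (k a - 1) a := by
  obtain ⟨hlen, hlab⟩ := ((oddOK_node k a ts false).1 h).1 rfl
  rw [List.eq_replicate_iff]
  refine ⟨by simpa using hlen, ?_⟩
  simpa using hlab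

theorem cdes_eq {k : ℕ → ℕ} (T : LTree) (b : Bool) (h : oddOK k T b) :
    T.cdes = evenSum cdesW T b := by
  induction T using LTree.induct generalizing b with
  | h a ts ih =>
    rw [evenSum_node, cdes_node,
      List.map_congr_left fun s hs => ih s hs (!b) (((oddOK_node k a ts b).1 h).2 s hs)]
    cases b
    · rw [map_label_of_oddOK h, ← List.replicate_succ, cdesW,
        countP_zip_rotate_replicate _ _ _ (by simp)]
      rfl
    · rfl

theorem casc_eq {k : ℕ → ℕ} (T : LTree) (b : Bool) (h : oddOK k T b) :
    T.casc = evenSum cascW T b := by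
  induction T using LTree.induct generalizing b with
  | h a ts ih =>
    rw [evenSum_node, casc_node,
      List.map_congr_left fun s hs => ih s hs (!b) (((oddOK_node k a ts b).1 h).2 s hs)]
    cases b
    · rw [map_label_of_oddOK h, ← List.replicate_succ, cascW,
        countP_zip_rotate_replicate _ _ _ (by simp)]
      rfl
    · rfl

/-! ### Canonical representatives and rearrangements -/

/-- A representative of the class of a tree up to reordering the children of even vertices. -/
noncomputable def canon : LTree → Bool → LTree
  | node a ts, b => node a (cond b
      (Multiset.toList (ts.attach.map (fun s => canon s.1 !b) : Multiset LTree))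
      (ts.attach.map (fun s => canon s.1 !b)))
decreasing_by all_goals exact sizeOf_lt_of_mem s.2

theorem canon_node (a : ℕ) (ts : List LTree) (b : Bool) :
    canon (node a ts) b = node a (cond b
      (Multiset.toList (ts.map (fun s => canon s !b) : Multiset LTree))
      (ts.map (fun s => canon s !b))) := by
  rw [canon, attach_map_eq ts fun s => canon s !b]

/-- All trees obtained by reordering the children of even vertices. -/
def rearr : LTree → Bool → List LTree
  | node a ts, b => (List.flatMap (fun L => L.sections.map (node a)) (cond b
      (ts.attach.map (fun s => rearr s.1 !b)).permutations'
      [ts.attach.map (fun s => rearr s.1 !b)]))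
decreasing_by all_goals exact sizeOf_lt_of_mem s.2

theorem rearr_node_false (a : ℕ) (ts : List LTree) :
    rearr (node a ts) false = (ts.map (fun s => rearr s true)).sections.map (node a) := by
  rw [rearr, attach_map_eq ts fun s => rearr s !false]
  simp

theorem rearr_node_true (a : ℕ) (ts : List LTree) :
    rearr (node a ts) true =
      ts.permutations'.flatMap fun σ =>
        (σ.map (fun s => rearr s false)).sections.map (node a) := by
  rw [rearr, attach_map_eq ts fun s => rearr s !true]
  simp only [cond_true, Bool.not_true]
  rw [← List.map_permutations', List.flatMap_map]

theorem mem_sections_map {ts us : List LTree} {f : LTree → List LTree} :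
    us ∈ (ts.map f).sections ↔ List.Forall₂ (fun u t => u ∈ f t) us ts := by
  rw [List.mem_sections, List.forall₂_map_right_iff]

theorem forall₂_canon {ts us : List LTree} {f : LTree → List LTree} {g : LTree → LTree}
    (h : ∀ t ∈ ts, ∀ u, u ∈ f t ↔ g u = g t) :
    List.Forall₂ (fun u t => u ∈ f t) us ts ↔ us.map g = ts.map g := by
  induction ts generalizing us with
  | nil => simp
  | cons t ts ih =>
    cases us with
    | nil => simp
    | cons u us =>
      simp only [List.forall₂_cons, List.map_cons, List.cons.injEq]
      rw [h t (by simp), ih fun t ht => h t (by simp [ht])]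

theorem exists_perm_map_eq {α β : Type*} {g : α → β} {l : List β} {ts : List α}
    (h : l.Perm (ts.map g)) : ∃ σ : List α, σ.Perm ts ∧ l = σ.map g := by
  have h' : (fun l ts => l.Perm (List.map g ts)) l ts := h
  rw [← List.eq_map_comp_perm] at h'
  obtain ⟨σ, h₁, h₂⟩ := h'
  exact ⟨σ, h₂, h₁⟩

theorem mem_rearr (T U : LTree) (b : Bool) : U ∈ rearr T b ↔ canon U b = canon T b := by
  induction T using LTree.induct generalizing b U with
  | h a ts ih =>
    obtain ⟨c, us⟩ := U
    rw [canon_node, canon_node]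
    cases b
    · rw [rearr_node_false]
      simp only [List.mem_map, node.injEq, mem_sections_map, cond_false, Bool.not_false]
      rw [← forall₂_canon fun t ht u => ih t ht u true]
      constructor
      · rintro ⟨l, hl, rfl, rfl⟩
        exact ⟨rfl, hl⟩
      · rintro ⟨rfl, hl⟩
        exact ⟨us, hl, rfl, rfl⟩
    · rw [rearr_node_true]
      simp only [List.mem_flatMap, List.mem_permutations', List.mem_map, node.injEq,
        mem_sections_map, cond_true, Bool.not_true]
      have hiff : (us.map (fun s => canon s false) : Multiset LTree).toList
            = (ts.map (fun s => canon s false) : Multiset LTree).toList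
          ↔ (us.map fun s => canon s false).Perm (ts.map fun s => canon s false) := by
        rw [← Multiset.coe_eq_coe]
        exact ⟨fun h => by rw [← Multiset.coe_toList (us.map fun s => canon s false : Multiset LTree), h,
          Multiset.coe_toList], fun h => by rw [h]⟩
      rw [hiff]
      constructor
      · rintro ⟨σ, hσ, l, hl, rfl, rfl⟩
        rw [forall₂_canon fun t ht u => ih t (hσ.mem_iff.1 ht) u false] at hl
        exact ⟨rfl, hl ▸ hσ.map _⟩
      · rintro ⟨rfl, hl⟩
        obtain ⟨σ, hσ, h⟩ := exists_perm_map_eq hl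
        exact ⟨σ, hσ, us,
          (forall₂_canon fun t ht u => ih t (hσ.mem_iff.1 ht) u false).2 h, rfl, rfl⟩

theorem label_canon (T : LTree) (b : Bool) : (canon T b).label = T.label := by
  obtain ⟨a, ts⟩ := T
  rw [canon_node]
  rfl

theorem labels_canon (T : LTree) (b : Bool) : (canon T b).labels = T.labels := by
  induction T using LTree.induct generalizing b with
  | h a ts ih =>
    have h : (ts.map fun s => (canon s !b).labels) = ts.map labels :=
      List.map_congr_left fun s hs => ih s hs _
    rw [canon_node, labels_node, labels_node]
    congr 1
    cases b
    · simp only [cond_false, List.map_map]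
      exact congrArg List.sum h
    · rw [cond_true, ← Multiset.sum_coe, ← Multiset.map_coe, Multiset.coe_toList,
        Multiset.map_coe, Multiset.sum_coe, List.map_map]
      exact congrArg List.sum h

theorem oddOK_canon (k : ℕ → ℕ) (T : LTree) (b : Bool) :
    oddOK k (canon T b) b ↔ oddOK k T b := by
  induction T using LTree.induct generalizing b with
  | h a ts ih =>
    rw [canon_node, oddOK_node, oddOK_node]
    cases b
    · simp +contextual [label_canon, ih]
    · simp +contextual [ih]

theorem nodup_sections {α : Type*} {L : List (List α)} (h : ∀ l ∈ L, l.Nodup) :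
    L.sections.Nodup := by
  induction L with
  | nil => simp
  | cons l L ih =>
    rw [List.sections, List.nodup_flatMap]
    refine ⟨fun s _ => (h l (by simp)).map fun a b hab => (List.cons.inj hab).1, ?_⟩
    refine List.Pairwise.imp (fun {s t} hst => ?_) (ih fun l' hl' => h l' (by simp [hl']))
    intro u hu hv
    obtain ⟨p, -, rfl⟩ := List.mem_map.1 hu
    obtain ⟨q, -, hq⟩ := List.mem_map.1 hv
    exact hst (List.cons.inj hq).2.symm

theorem sum_sections_prod {α R : Type*} [CommSemiring R] (g : α → R) (L : List (List α)) :
    (L.sections.map fun us => (us.map g).prod).sum = (L.map fun l => (l.map g).sum).prod := by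
  induction L with
  | nil => simp
  | cons l L ih =>
    rw [List.sections, list_sum_map_flatMap, List.map_cons, List.prod_cons, ← ih,
      ← List.sum_map_mul_left]
    simp [Function.comp_def, List.sum_map_mul_right]

theorem label_of_mem_rearr {T U : LTree} {b : Bool} (h : U ∈ rearr T b) : U.label = T.label := by
  rw [← label_canon U b, (mem_rearr T U b).1 h, label_canon]

theorem map_label_of_mem_sections {b : Bool} {σ us : List LTree}
    (h : us ∈ (σ.map fun s => rearr s b).sections) : us.map label = σ.map label := by
  rw [mem_sections_map] at h
  induction h with
  | nil => rfl
  | cons h _ ih => rw [List.map_cons, List.map_cons, label_of_mem_rearr h, ih]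

theorem nodup_of_mem_evenWords_child {a : ℕ} {ts : List LTree} {b : Bool}
    (h : ∀ w ∈ evenWords (node a ts) b, w.Nodup) {s : LTree} (hs : s ∈ ts) :
    ∀ w ∈ evenWords s (!b), w.Nodup := fun w hw => h w <| by
  rw [evenWords_node]
  exact List.mem_append_right _ (List.mem_flatMap.2 ⟨s, hs, hw⟩)

theorem node_word_nodup {a : ℕ} {ts : List LTree}
    (h : ∀ w ∈ evenWords (node a ts) true, w.Nodup) : (a :: ts.map label).Nodup :=
  h _ (by simp [evenWords_node])

theorem nodup_rearr (T : LTree) (b : Bool) (h : ∀ w ∈ evenWords T b, w.Nodup) :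
    (rearr T b).Nodup := by
  induction T using LTree.induct generalizing b with
  | h a ts ih =>
    have hinj : Function.Injective (node a) := fun _ _ h => (node.inj h).2
    have hch : ∀ s ∈ ts, (rearr s (!b)).Nodup := fun s hs =>
      ih s hs _ (nodup_of_mem_evenWords_child h hs)
    cases b
    · rw [rearr_node_false]
      exact (nodup_sections (by simpa using hch)).map hinj
    · have hnd := (List.nodup_cons.1 (node_word_nodup h)).2
      rw [rearr_node_true, List.nodup_flatMap]
      constructor
      · intro σ hσ
        have hσ := List.mem_permutations'.1 hσ
        exact (nodup_sections (by simpa [hσ.mem_iff] using hch)).map hinj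
      · have hperm : (ts.permutations'.map (List.map label)).Nodup := by
          rw [List.map_permutations', ← (List.permutations_perm_permutations' _).nodup_iff]
          exact List.nodup_permutations _ hnd
        refine List.Pairwise.imp (fun {σ τ} hne => ?_) (List.pairwise_map.1 hperm)
        intro u hu hv
        obtain ⟨p, hp, rfl⟩ := List.mem_map.1 hu
        obtain ⟨q, hq, hpq⟩ := List.mem_map.1 hv
        rw [← hinj hpq] at hp
        exact hne (by rw [← map_label_of_mem_sections hp, map_label_of_mem_sections hq])

/-- The product of the weights of the words of the even vertices. -/
def treeWeight {R : Type*} [CommRing R] (w : List ℕ → R) (b : Bool) (T : LTree) : R :=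
  ((evenWords T b).map w).prod

section Weight

variable {R : Type*} [CommRing R] (w : List ℕ → R)

theorem treeWeight_node (a : ℕ) (ts : List LTree) (b : Bool) :
    treeWeight w b (node a ts)
      = cond b (w (a :: ts.map label)) 1 * (ts.map (treeWeight w !b)).prod := by
  have : ((ts.flatMap fun s => evenWords s !b).map w).prod = (ts.map (treeWeight w !b)).prod := by
    induction ts with
    | nil => rfl
    | cons t ts ih => simp [List.flatMap_cons, ih, treeWeight]
  rw [treeWeight, evenWords_node, List.map_append, List.prod_append, this]
  cases b <;> simp

theorem sum_treeWeight_rearr_false (a : ℕ) (ts : List LTree) :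
    ((rearr (node a ts) false).map (treeWeight w false)).sum
      = (ts.map fun t => ((rearr t true).map (treeWeight w true)).sum).prod := by
  rw [rearr_node_false, List.map_map]
  have : treeWeight w false ∘ node a = fun us => (us.map (treeWeight w true)).prod := by
    ext us
    simp [treeWeight_node]
  rw [this, sum_sections_prod, List.map_map]
  rfl

theorem sum_treeWeight_rearr_true (a : ℕ) (ts : List LTree) :
    ((rearr (node a ts) true).map (treeWeight w true)).sum
      = ((ts.map label).permutations'.map fun τ => w (a :: τ)).sum
        * (ts.map fun t => ((rearr t false).map (treeWeight w false)).sum).prod := by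
  rw [rearr_node_true, list_sum_map_flatMap, ← List.map_permutations', List.map_map,
    ← List.sum_map_mul_right]
  congr 1
  refine List.map_congr_left fun σ hσ => ?_
  have hσ := List.mem_permutations'.1 hσ
  rw [List.map_map, ← (hσ.map _).prod_eq, Function.comp_apply]
  have : ((σ.map fun s => rearr s false).sections.map (treeWeight w true ∘ node a))
      = (σ.map fun s => rearr s false).sections.map
          fun us => w (a :: σ.map label) * (us.map (treeWeight w false)).prod := by
    refine List.map_congr_left fun us hus => ?_
    simp [treeWeight_node, map_label_of_mem_sections hus]
  rw [this, List.sum_map_mul_left, sum_sections_prod, List.map_map]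
  rfl

theorem sum_rearr_eq (x y z : R) (T : LTree) (b : Bool) (h : ∀ w ∈ evenWords T b, w.Nodup) :
    ((rearr T b).map (treeWeight (ascDescWeight x y z) b)).sum
      = ((rearr T b).map (treeWeight (gammaWeight x y z) b)).sum := by
  induction T using LTree.induct generalizing b with
  | h a ts ih =>
    have hch := List.map_congr_left fun s (hs : s ∈ ts) =>
      ih s hs _ (nodup_of_mem_evenWords_child h hs)
    cases b
    · rw [sum_treeWeight_rearr_false, sum_treeWeight_rearr_false]
      exact congrArg List.prod hch
    · rw [sum_treeWeight_rearr_true, sum_treeWeight_rearr_true,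
        sum_ascDescWeight_eq_sum_gammaWeight x y z (node_word_nodup h)]
      exact congrArg _ (congrArg List.prod hch)

end Weight

/-! ### The labels of odd vertices -/

/-- The multiset of labels of the odd vertices (`b = true` meaning that the root is even). -/
def oddLabels : LTree → Bool → Multiset ℕ
  | node a ts, b => (cond b 0 {a}) + (ts.attach.map (fun s => oddLabels s.1 !b)).sum
decreasing_by exact sizeOf_lt_of_mem s.2

theorem oddLabels_node (a : ℕ) (ts : List LTree) (b : Bool) :
    oddLabels (node a ts) b = (cond b 0 {a}) + (ts.map (fun s => oddLabels s !b)).sum := by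
  rw [oddLabels, attach_map_eq ts fun s => oddLabels s !b]

theorem sum_map_bind (f : ℕ → Multiset ℕ) (g h : LTree → Multiset ℕ) (ts : List LTree) :
    (ts.map fun s => g s + (h s).bind f).sum
      = (ts.map g).sum + ((ts.map h).sum).bind f := by
  induction ts with
  | nil => simp
  | cons t ts ih =>
    simp only [List.map_cons, List.sum_cons, ih, Multiset.add_bind]
    abel

theorem labels_eq_of_oddOK {k : ℕ → ℕ} (T : LTree) (b : Bool) (h : oddOK k T b) :
    T.labels = cond b {T.label} 0
      + (oddLabels T b).bind fun i => Multiset.replicate (k i - 1 + 1) i := by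
  induction T using LTree.induct generalizing b with
  | h a ts ih =>
    obtain ⟨h₁, h₂⟩ := (oddOK_node k a ts b).1 h
    rw [labels_node, oddLabels_node, List.map_congr_left fun s hs => ih s hs _ (h₂ s hs),
      sum_map_bind]
    cases b
    · have hlab : (ts.map fun s => ({s.label} : Multiset ℕ)).sum
          = Multiset.replicate (k a - 1) a := by
        have : (ts.map fun s => ({s.label} : Multiset ℕ)) = (ts.map label).map singleton := by
          rw [List.map_map]; rfl
        rw [this, map_label_of_oddOK h]
        simp [List.map_replicate, List.sum_replicate, Multiset.nsmul_singleton]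
      simp [hlab, Multiset.replicate_succ]
      abel
    · simp [label, Multiset.singleton_add]

theorem card_labels (T : LTree) (b : Bool) :
    T.labels.card = (evenWords T b).length + (oddLabels T b).card := by
  induction T using LTree.induct generalizing b with
  | h a ts ih =>
    have : (ts.map labels).sum.card = (ts.flatMap fun s => evenWords s !b).length
        + ((ts.map fun s => oddLabels s !b).sum).card := by
      clear * - ih
      induction ts with
      | nil => simp
      | cons t ts iht =>
        have := iht fun s hs => ih s (by simp [hs])
        have := ih t (by simp) (!b)
        simp only [List.map_cons, List.sum_cons, Multiset.card_add, List.flatMap_cons,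
          List.length_append]
        omega
    rw [labels_node, evenWords_node, oddLabels_node, Multiset.card_cons, this]
    cases b <;> simp <;> omega

theorem sum_length_evenWords (T : LTree) (b : Bool) :
    ((evenWords T b).map List.length).sum + cond b 0 1 = T.labels.card := by
  induction T using LTree.induct generalizing b with
  | h a ts ih =>
    have : (ts.map labels).sum.card = ((ts.flatMap fun s => evenWords s !b).map List.length).sum
        + cond b ts.length 0 := by
      clear * - ih
      induction ts with
      | nil => simp
      | cons t ts iht =>
        have := iht fun s hs => ih s (by simp [hs])
        have := ih t (by simp) (!b)
        simp only [List.map_cons, List.sum_cons, Multiset.card_add, List.flatMap_cons,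
          List.map_append, List.sum_append]
        cases b <;> simp at * <;> omega
    rw [labels_node, evenWords_node, Multiset.card_cons, this]
    cases b <;> simp; omega

theorem oddLabels_le_of_mem {ts : List LTree} {s : LTree} (hs : s ∈ ts) (b : Bool) :
    oddLabels s b ≤ (ts.map fun s => oddLabels s b).sum := by
  exact List.single_le_sum (by simp) _ (List.mem_map_of_mem hs)

theorem map_label_le (ts : List LTree) :
    (ts.map label : Multiset ℕ) ≤ (ts.map fun s => oddLabels s false).sum := by
  induction ts with
  | nil => simp
  | cons t ts ih =>
    have : {t.label} ≤ oddLabels t false := by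
      obtain ⟨a, us⟩ := t
      rw [oddLabels_node]
      exact Multiset.le_add_right _ _
    rw [List.map_cons, List.map_cons, List.sum_cons, ← Multiset.cons_coe,
      ← Multiset.singleton_add]
    exact add_le_add this ih

theorem nodup_evenWords {k : ℕ → ℕ} (T : LTree) (b : Bool) (h : oddOK k T b)
    (hnd : (cond b {T.label} 0 + oddLabels T b).Nodup) : ∀ w ∈ evenWords T b, w.Nodup := by
  induction T using LTree.induct generalizing b with
  | h a ts ih =>
    obtain ⟨h₁, h₂⟩ := (oddOK_node k a ts b).1 h
    rw [oddLabels_node] at hnd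
    intro w hw
    rw [evenWords_node, List.mem_append] at hw
    rcases hw with hw | hw
    · cases b
      · simp at hw
      · simp only [cond_true, List.mem_singleton] at hw
        subst hw
        rw [← Multiset.coe_nodup, ← Multiset.cons_coe, ← Multiset.singleton_add]
        refine Multiset.nodup_of_le ?_ hnd
        refine (add_le_add le_rfl (map_label_le ts)).trans ?_
        simp [label]
    · obtain ⟨s, hs, hw⟩ := List.mem_flatMap.1 hw
      refine ih s hs _ (h₂ s hs) (Multiset.nodup_of_le ?_ hnd) w hw
      have := oddLabels_le_of_mem hs (!b)
      cases b
      · simpa [(h₁ rfl).2 s hs] using this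
      · simp only [Bool.not_true, cond_false, zero_add]
        exact le_add_left (le_add_left this)

/-! ### The set `𝒯_M` -/

theorem count_bind_replicate (k : ℕ → ℕ) (m : Multiset ℕ) (i : ℕ) :
    (m.bind fun i => Multiset.replicate (k i - 1 + 1) i).count i
      = m.count i * (k i - 1 + 1) := by
  induction m using Multiset.induction with
  | empty => simp
  | cons j m ih =>
    rw [Multiset.cons_bind, Multiset.count_add, ih, Multiset.count_replicate, Multiset.count_cons]
    by_cases h : j = i
    · subst h
      simp
      ring
    · simp [h, Ne.symm h]

theorem count_msetM (n : ℕ) (k : ℕ → ℕ) (i : ℕ) :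
    (msetM n k).count i = if i ∈ Finset.Icc 1 n then k i else 0 := by
  rw [msetM, Multiset.count_sum']
  simp only [Multiset.count_replicate]
  rw [Finset.sum_ite_eq']

theorem card_msetM (n : ℕ) (k : ℕ → ℕ) : (msetM n k).card = ∑ i ∈ Finset.Icc 1 n, k i := by
  simp [msetM]

theorem oddLabels_eq_of_memTM {n : ℕ} {k : ℕ → ℕ} (hk : ∀ i, 1 ≤ i → i ≤ n → 1 ≤ k i)
    {T : LTree} (hT : memTM n k T) : oddLabels T true = (Finset.Icc 1 n).val := by
  obtain ⟨h0, hl, hok⟩ := hT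
  have h := labels_eq_of_oddOK T true hok
  rw [hl, cond_true, h0, Multiset.singleton_add, Multiset.cons_inj_right] at h
  ext i
  have hi := congrArg (Multiset.count i) h
  rw [count_msetM, count_bind_replicate] at hi
  rw [Multiset.count_eq_of_nodup (Finset.Icc 1 n).nodup]
  simp only [Finset.mem_val]
  by_cases hin : i ∈ Finset.Icc 1 n
  · rw [if_pos hin] at hi ⊢
    rw [Finset.mem_Icc] at hin
    have hki := hk i hin.1 hin.2
    rw [Nat.sub_add_cancel hki] at hi
    exact Nat.eq_of_mul_eq_mul_right hki (by omega)
  · rw [if_neg hin] at hi ⊢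
    exact (Nat.mul_eq_zero.1 hi.symm).resolve_right (by omega)

theorem nodup_evenWords_of_memTM {n : ℕ} {k : ℕ → ℕ} (hk : ∀ i, 1 ≤ i → i ≤ n → 1 ≤ k i)
    {T : LTree} (hT : memTM n k T) : ∀ w ∈ evenWords T true, w.Nodup := by
  refine nodup_evenWords T true hT.2.2 ?_
  rw [oddLabels_eq_of_memTM hk hT, hT.1, cond_true, Multiset.singleton_add, Multiset.nodup_cons]
  exact ⟨by simp, (Finset.Icc 1 n).nodup⟩

theorem memTM_of_canon_eq {n : ℕ} {k : ℕ → ℕ} {T U : LTree} (h : canon U true = canon T true)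
    (hT : memTM n k T) : memTM n k U := by
  refine ⟨?_, ?_, ?_⟩
  · rw [← label_canon U true, h, label_canon, hT.1]
  · rw [← labels_canon U true, h, labels_canon, hT.2.1]
  · rw [← oddOK_canon, h, oddOK_canon]
    exact hT.2.2

theorem finite_lists_of_finite {α : Type*} {S : Set α} (hS : S.Finite) (N : ℕ) :
    {l : List α | l.length ≤ N ∧ ∀ t ∈ l, t ∈ S}.Finite := by
  have := hS.to_subtype
  refine ((List.finite_length_le S N).image (List.map Subtype.val)).subset ?_
  rintro l ⟨hlen, hl⟩
  lift l to List S using hl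
  exact ⟨l, by simpa using hlen, rfl⟩

theorem finite_bounded_trees (N B : ℕ) :
    {T : LTree | T.labels.card ≤ N ∧ ∀ i ∈ T.labels, i ≤ B}.Finite := by
  induction N with
  | zero =>
    refine Set.finite_empty.subset ?_
    rintro ⟨a, ts⟩ ⟨h, -⟩
    simp [labels_node] at h
  | succ N ih =>
    refine (Set.Finite.image2 node (Set.finite_Iic B) (finite_lists_of_finite ih N)).subset ?_
    rintro ⟨a, ts⟩ ⟨hcard, hB⟩
    rw [labels_node] at hcard hB
    rw [Multiset.card_cons] at hcard
    have hle : ∀ t ∈ ts, t.labels ≤ (ts.map labels).sum := fun t ht =>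
      List.single_le_sum (by simp) _ (List.mem_map_of_mem ht)
    have hlen : ts.length ≤ (ts.map labels).sum.card := by
      clear * -
      induction ts with
      | nil => simp
      | cons t ts ih =>
        obtain ⟨b, us⟩ := t
        simp only [List.map_cons, List.sum_cons, Multiset.card_add, List.length_cons, labels_node,
          Multiset.card_cons]
        omega
    refine ⟨a, hB a (by simp), ts, ⟨by omega, fun t ht => ⟨?_, fun i hi => ?_⟩⟩, rfl⟩
    · have := Multiset.card_le_card (hle t ht)
      omega
    · exact hB i (Multiset.mem_cons_of_mem (Multiset.mem_of_le (hle t ht) hi))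

theorem finite_memTM (n : ℕ) (k : ℕ → ℕ) : {T : LTree | memTM n k T}.Finite := by
  refine (finite_bounded_trees ((msetM n k).card + 1) n).subset ?_
  rintro T ⟨-, hl, -⟩
  refine ⟨by simp [hl], fun i hi => ?_⟩
  rw [hl, Multiset.mem_cons, msetM, Multiset.mem_sum] at hi
  rcases hi with rfl | ⟨j, hj, hi⟩
  · exact Nat.zero_le n
  · rw [Multiset.eq_of_mem_replicate hi]
    exact (Finset.mem_Icc.1 hj).2

theorem sum_memTM_eq {R : Type*} [CommRing R] (x y z : R) {n : ℕ} {k : ℕ → ℕ}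
    (hk : ∀ i, 1 ≤ i → i ≤ n → 1 ≤ k i) :
    ∑ T ∈ (finite_memTM n k).toFinset, treeWeight (ascDescWeight x y z) true T
      = ∑ T ∈ (finite_memTM n k).toFinset, treeWeight (gammaWeight x y z) true T := by
  set s := (finite_memTM n k).toFinset with hs
  have hmaps : ∀ T ∈ s, canon T true ∈ s.image fun T => canon T true := fun T hT =>
    Finset.mem_image_of_mem _ hT
  rw [← Finset.sum_fiberwise_of_maps_to hmaps, ← Finset.sum_fiberwise_of_maps_to hmaps]
  refine Finset.sum_congr rfl fun C hC => ?_
  obtain ⟨T, hT, rfl⟩ := Finset.mem_image.1 hC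
  have hT' : memTM n k T := by simpa [hs] using hT
  have hfib : s.filter (fun U => canon U true = canon T true) = (rearr T true).toFinset := by
    ext U
    simp only [Finset.mem_filter, List.mem_toFinset, mem_rearr, hs, Set.Finite.mem_toFinset,
      Set.mem_ofPred_eq, and_iff_right_iff_imp]
    exact fun h => memTM_of_canon_eq h hT'
  have hgood := nodup_evenWords_of_memTM hk hT'
  have hnd := nodup_rearr T true hgood
  rw [hfib, List.sum_toFinset _ hnd, List.sum_toFinset _ hnd, sum_rearr_eq x y z T true hgood]

theorem treeWeight_ascDescWeight {R : Type*} [CommRing R] (x y z : R) {k : ℕ → ℕ} {T : LTree}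
    (h : oddOK k T true) :
    treeWeight (ascDescWeight x y z) true T = x ^ T.casc * y ^ T.cdes * z ^ T.eleaf := by
  rw [casc_eq T true h, cdes_eq T true h, eleaf_eq, evenSum_eq, evenSum_eq, evenSum_eq, treeWeight]
  induction evenWords T true with
  | nil => simp
  | cons w ws ih =>
    simp only [List.map_cons, List.prod_cons, List.sum_cons, ih, ascDescWeight]
    ring

theorem prod_gammaWeight {R : Type*} [CommRing R] (x y z : R) (ws : List (List ℕ)) :
    (ws.map (gammaWeight x y z)).prod =
      if (ws.map dcdesW).sum = 0 then
        (x * y) ^ (ws.map cdesW).sum * (x + y) ^ (ws.map freeW).sum * z ^ (ws.map leafW).sum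
      else 0 := by
  induction ws with
  | nil => simp
  | cons w ws ih =>
    simp only [List.map_cons, List.prod_cons, List.sum_cons, ih, gammaWeight, Nat.add_eq_zero_iff]
    by_cases h₁ : dcdesW w = 0 <;> by_cases h₂ : (ws.map dcdesW).sum = 0 <;> simp [h₁, h₂]
    ring

theorem ne_nil_of_mem_evenWords (T : LTree) (b : Bool) : ∀ w ∈ evenWords T b, w ≠ [] := by
  induction T using LTree.induct generalizing b with
  | h a ts ih =>
    intro w hw
    rw [evenWords_node, List.mem_append, List.mem_flatMap] at hw
    rcases hw with hw | ⟨s, hs, hw⟩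
    · cases b <;> simp_all
    · exact ih s hs _ w hw

theorem sum_freeW_add {ws : List (List ℕ)} (hne : ∀ w ∈ ws, w ≠ []) (hnd : ∀ w ∈ ws, w.Nodup)
    (h0 : (ws.map dcdesW).sum = 0) :
    (ws.map freeW).sum + (ws.map leafW).sum + 2 * (ws.map cdesW).sum
      = (ws.map List.length).sum := by
  induction ws with
  | nil => rfl
  | cons w ws ih =>
    rw [List.map_cons, List.sum_cons, Nat.add_eq_zero_iff] at h0
    have h₁ := freeW_add (hne w (by simp)) (hnd w (by simp)) h0.1
    have h₂ := ih (fun w hw => hne w (by simp [hw])) (fun w hw => hnd w (by simp [hw])) h0.2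
    simp only [List.map_cons, List.sum_cons]
    omega

theorem sum_leafW_le_length (ws : List (List ℕ)) : (ws.map leafW).sum ≤ ws.length := by
  induction ws with
  | nil => rfl
  | cons w ws ih =>
    have : leafW w ≤ 1 := by rw [leafW]; split <;> omega
    rw [List.map_cons, List.sum_cons, List.length_cons]
    omega

theorem freeW_add_of_memTM {n : ℕ} {k : ℕ → ℕ} (hk : ∀ i, 1 ≤ i → i ≤ n → 1 ≤ k i) {T : LTree}
    (hT : memTM n k T) (h0 : T.dcdes = 0) :
    evenSum freeW T true + T.eleaf + 2 * T.cdes = (∑ i ∈ Finset.Icc 1 n, k i) + 1 := by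
  rw [dcdes, evenSum_eq] at h0
  have h := sum_freeW_add (ne_nil_of_mem_evenWords T true) (nodup_evenWords_of_memTM hk hT) h0
  have hlen := sum_length_evenWords T true
  rw [hT.2.1, Multiset.card_cons, card_msetM, cond_true, add_zero] at hlen
  rw [eleaf_eq, cdes_eq T true hT.2.2, evenSum_eq, evenSum_eq, evenSum_eq, h, hlen]

theorem cdes_pos_and_eleaf_le {n : ℕ} {k : ℕ → ℕ} (hk : ∀ i, 1 ≤ i → i ≤ n → 1 ≤ k i) {T : LTree}
    (hT : memTM n k T) (hn : 1 ≤ n) :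
    1 ≤ T.cdes ∧ T.eleaf ≤ (∑ i ∈ Finset.Icc 1 n, k i) - n := by
  have hgood := nodup_evenWords_of_memTM hk hT
  have hodd := oddLabels_eq_of_memTM hk hT
  have hcard := card_labels T true
  rw [hT.2.1, hodd, Multiset.card_cons, card_msetM] at hcard
  simp only [Finset.card_val, Nat.card_Icc, Nat.add_sub_cancel] at hcard
  rw [eleaf_eq, cdes_eq T true hT.2.2, evenSum_eq, evenSum_eq]
  obtain ⟨a, ts⟩ := T
  have hts : ts ≠ [] := by
    rintro rfl
    have := congrArg Multiset.card hodd
    simp [oddLabels_node] at this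
    omega
  have hmap : ts.map label ≠ [] := by simpa using hts
  have hpos := cdesW_pos hmap (node_word_nodup hgood)
  rw [evenWords_node] at hcard ⊢
  have hle := sum_leafW_le_length (ts.flatMap fun s => evenWords s !true)
  simp only [cond_true, List.singleton_append, List.map_cons, List.sum_cons, List.length_cons,
    leafW_cons hmap] at hcard ⊢
  omega

theorem treeWeight_gammaWeight {R : Type*} [CommRing R] (x y z : R) {n : ℕ} {k : ℕ → ℕ}
    (hk : ∀ i, 1 ≤ i → i ≤ n → 1 ≤ k i) {T : LTree} (hT : memTM n k T) :
    treeWeight (gammaWeight x y z) true T =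
      if T.dcdes = 0 then (x * y) ^ T.cdes
        * (x + y) ^ ((∑ i ∈ Finset.Icc 1 n, k i) + 1 - T.eleaf - 2 * T.cdes) * z ^ T.eleaf
      else 0 := by
  by_cases h0 : T.dcdes = 0
  · have h := freeW_add_of_memTM hk hT h0
    rw [treeWeight, prod_gammaWeight, ← evenSum_eq, ← evenSum_eq, ← evenSum_eq, ← evenSum_eq,
      ← cdes_eq T true hT.2.2, ← eleaf_eq, ← dcdes, if_pos h0, if_pos h0]
    congr 3
    omega
  · rw [treeWeight, prod_gammaWeight, ← evenSum_eq, ← dcdes, if_neg h0, if_neg h0]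

end LTree

open MvPolynomial in
/-- **Theorem 2.2 (Yan–Huang–Yang).**  For `M = {1^{k 1}, …, n^{k n}}` with every `k i ≥ 1`
and `K = k 1 + ⋯ + k n`, the polynomial
`T_M(x,y,z) = ∑_{T ∈ 𝒯_M} x^{casc T} y^{cdes T} z^{eleaf T}` is partial γ-positive, with
`T_M(x,y,z) = ∑_{i=0}^{K-n} z^i ∑_{j=1}^{⌊(K+1-i)/2⌋} γ_{i,j} (xy)^j (x+y)^{K+1-i-2j}`,
where `γ_{i,j} = #{T ∈ 𝒯_M : cdes T = j, eleaf T = i, dcdes T = 0}`.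
Here `x = X 0`, `y = X 1`, `z = X 2` in `ℤ[x,y,z] = MvPolynomial (Fin 3) ℤ`. -/
theorem tree_poly_partial_gamma_positive
    (n : ℕ) (hn : 1 ≤ n) (k : ℕ → ℕ) (hk : ∀ i, 1 ≤ i → i ≤ n → 1 ≤ k i)
    (K : ℕ) (hK : K = ∑ i ∈ Finset.Icc 1 n, k i) :
    (∑ᶠ T ∈ {T : LTree | memTM n k T},
        (X 0 : MvPolynomial (Fin 3) ℤ) ^ T.casc * X 1 ^ T.cdes * X 2 ^ T.eleaf)
      = ∑ i ∈ Finset.range (K - n + 1), (X 2 : MvPolynomial (Fin 3) ℤ) ^ i *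
          ∑ j ∈ Finset.Icc 1 ((K + 1 - i) / 2),
            ({T : LTree | memTM n k T ∧ T.cdes = j ∧ T.eleaf = i ∧ T.dcdes = 0}.ncard :
                MvPolynomial (Fin 3) ℤ)
              * (X 0 * X 1) ^ j * (X 0 + X 1) ^ (K + 1 - i - 2 * j) := by
  subst hK
  set s := (LTree.finite_memTM n k).toFinset with hs
  have hmem : ∀ T, T ∈ s ↔ memTM n k T := fun T => by simp [hs]
  rw [finsum_mem_eq_finite_toFinset_sum _ (LTree.finite_memTM n k), ← hs,
    ← Finset.sum_congr rfl fun T hT =>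
      LTree.treeWeight_ascDescWeight (X 0) (X 1) (X 2) ((hmem T).1 hT).2.2,
    hs, LTree.sum_memTM_eq _ _ _ hk, ← hs, Finset.sum_congr rfl fun T hT =>
      LTree.treeWeight_gammaWeight _ _ _ hk ((hmem T).1 hT)]
  have hcard : ∀ i j : ℕ,
      ({T : LTree | memTM n k T ∧ T.cdes = j ∧ T.eleaf = i ∧ T.dcdes = 0}.ncard :
          MvPolynomial (Fin 3) ℤ)
        = ∑ T ∈ s, if T.eleaf = i then if T.cdes = j then if T.dcdes = 0 then 1 else 0
            else 0 else 0 := by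
    intro i j
    have : {T : LTree | memTM n k T ∧ T.cdes = j ∧ T.eleaf = i ∧ T.dcdes = 0}
        = (s.filter fun T => T.eleaf = i ∧ T.cdes = j ∧ T.dcdes = 0 : Finset LTree) := by
      ext T
      simp only [Finset.coe_filter, Set.mem_ofPred_eq, hmem]
      tauto
    rw [this, Set.ncard_coe_finset, Finset.card_filter]
    push_cast
    refine Finset.sum_congr rfl fun T _ => ?_
    simp only [← ite_and]
  simp only [hcard, Finset.sum_mul, Finset.mul_sum]
  rw [Finset.sum_congr rfl fun i _ => Finset.sum_comm, Finset.sum_comm]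
  refine Finset.sum_congr rfl fun T hT => ?_
  have hT := (hmem T).1 hT
  by_cases h0 : T.dcdes = 0
  · obtain ⟨hpos, hle⟩ := LTree.cdes_pos_and_eleaf_le hk hT hn
    have hadd := LTree.freeW_add_of_memTM hk hT h0
    generalize ∑ i ∈ Finset.Icc 1 n, k i = K at hle hadd ⊢
    rw [Finset.sum_eq_single_of_mem T.eleaf (by rw [Finset.mem_range]; omega),
      Finset.sum_eq_single_of_mem T.cdes (by rw [Finset.mem_Icc]; omega)]
    · simp only [h0, if_true]
      ring
    · intro j _ hj
      simp [Ne.symm hj]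
    · intro i _ hi
      simp [Ne.symm hi]
  · simp [h0]
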